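/- For d ≥ 2, κ_i > −1 (i = 1,…,d+1), n ∈ ℕ_0 and a polynomial f in d variables of degree at most n, equality holds in the inequality Σ_{i=1}^d ‖ √(x_i(1−|x|)) ∂_i f ‖_{κ,2}² + Σ_{1≤i<j≤d} ‖ √(x_i x_j) ∂_{i,j} f ‖_{κ,2}² ≤ n(n+|κ|+d) ‖f‖_{κ,2}² if and only if f belongs to V_n^d(W_κ). -/

import Mathlib

open MeasureTheory Finset

noncomputable section

/-- The simplex `△^d = {x : x_i ≥ 0, x_1 + ⋯ + x_d ≤ 1}`. -/
def Splx (d : ℕ) : Set (Fin d → ℝ) := {x | (∀ i, 0 ≤ x i) ∧ ∑ i, x i ≤ 1}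

/-- The `i`-th partial derivative. -/
def pd {d : ℕ} (i : Fin d) (f : (Fin d → ℝ) → ℝ) : (Fin d → ℝ) → ℝ :=
  fun x => fderiv ℝ f x (Pi.single i 1)

/-- `∂_{i,j} = ∂_i - ∂_j`. -/
def pdd {d : ℕ} (i j : Fin d) (f : (Fin d → ℝ) → ℝ) : (Fin d → ℝ) → ℝ :=
  fun x => pd i f x - pd j f x

/-- `⟨x,∇⟩ = ∑ x_i ∂_i`. -/
def xgrad {d : ℕ} (f : (Fin d → ℝ) → ℝ) : (Fin d → ℝ) → ℝ :=
  fun x => ∑ i, x i * pd i f x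

/-- The Jacobi weight `W_κ(x) = x_1^{κ_1} ⋯ x_d^{κ_d} (1-|x|)^{κ_{d+1}}`. -/
def Wk {d : ℕ} (κ : Fin (d+1) → ℝ) (x : Fin d → ℝ) : ℝ :=
  (∏ i : Fin d, x i ^ κ i.castSucc) * (1 - ∑ i, x i) ^ κ (Fin.last d)

/-- The spectral operator `D_κ`. -/
def Dk {d : ℕ} (κ : Fin (d+1) → ℝ) (f : (Fin d → ℝ) → ℝ) (x : Fin d → ℝ) : ℝ :=
  (∑ i, x i * (1 - x i) * pd i (pd i f) x)
    - 2 * ∑ i, ∑ j ∈ Finset.univ.filter (fun j => i < j), x i * x j * pd i (pd j f) x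
    + ∑ i, (κ i.castSucc + 1 - ((∑ k, κ k) + (d : ℝ) + 1) * x i) * pd i f x

/-- The normalizing constant `b_κ`. -/
def bk {d : ℕ} (κ : Fin (d+1) → ℝ) : ℝ :=
  Real.Gamma ((∑ i, κ i) + (d : ℝ) + 1) / ∏ i, Real.Gamma (κ i + 1)

/-- The inner product `⟨f,g⟩_κ = b_κ ∫_{△^d} f g W_κ`. -/
def ipk {d : ℕ} (κ : Fin (d+1) → ℝ) (f g : (Fin d → ℝ) → ℝ) : ℝ :=
  bk κ * ∫ x in Splx d, f x * g x * Wk κ x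

/-- The norm `‖f‖_{κ,2}`. -/
def nrm2 {d : ℕ} (κ : Fin (d+1) → ℝ) (f : (Fin d → ℝ) → ℝ) : ℝ :=
  Real.sqrt (ipk κ f f)

/-- Membership in `V_n^d(W_κ)`: a polynomial of degree (at most) `n` orthogonal to all
polynomials of lower degree. -/
def InVn (d n : ℕ) (κ : Fin (d+1) → ℝ) (f : MvPolynomial (Fin d) ℝ) : Prop :=
  f.totalDegree ≤ n ∧ ∀ g : MvPolynomial (Fin d) ℝ, g.totalDegree < n →
    ipk κ (fun x => MvPolynomial.eval x f) (fun x => MvPolynomial.eval x g) = 0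

/-- `x_k` for `1 ≤ k ≤ d+1`, with the convention `x_{d+1} = 1 - |x|`. -/
def xe {d : ℕ} (x : Fin d → ℝ) (k : Fin (d+1)) : ℝ :=
  if h : (k : ℕ) < d then x ⟨(k : ℕ), h⟩ else 1 - ∑ i, x i

/-- The quantity `Σ_i ‖√(x_i(1-|x|)) ∂_i f‖²_{κ,2} + Σ_{i<j} ‖√(x_i x_j) ∂_{i,j} f‖²_{κ,2}`. -/
def bform {d : ℕ} (κ : Fin (d+1) → ℝ) (F : (Fin d → ℝ) → ℝ) : ℝ :=
  (∑ i, nrm2 κ (fun x => Real.sqrt (x i * (1 - ∑ k, x k)) * pd i F x) ^ 2) +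
  ∑ i, ∑ j ∈ Finset.univ.filter (fun j => i < j),
    nrm2 κ (fun x => Real.sqrt (x i * x j) * pdd i j F x) ^ 2

theorem lintegral_Ioo_rpow_mul_sub_rpow {α β r : ℝ} (hα : 0 < α) (hβ : 0 < β) (hr : 0 < r) :
    ∫⁻ x in Set.Ioo 0 r, ENNReal.ofReal (x ^ (α - 1) * (r - x) ^ (β - 1)) =
      ENNReal.ofReal (r ^ (α + β - 1) * ProbabilityTheory.beta α β) := by
  have hB := ProbabilityTheory.beta_pos hα hβ
  have himg : Set.Ioo 0 r = (fun y => r * y) '' Set.Ioo 0 1 := by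
    rw [Set.image_mul_left_Ioo hr]; simp
  have hone := ProbabilityTheory.lintegral_betaPDF_eq_one hα hβ
  rw [ProbabilityTheory.lintegral_betaPDF] at hone
  rw [himg, lintegral_image_eq_lintegral_abs_deriv_mul (f' := fun _ => r) measurableSet_Ioo
    (fun x _ => by simpa using ((hasDerivAt_id x).const_mul r).hasDerivWithinAt)
    (mul_right_injective₀ hr.ne').injOn]
  calc _ = ∫⁻ x in Set.Ioo (0:ℝ) 1,
        ENNReal.ofReal (r ^ (α + β - 1) * ProbabilityTheory.beta α β) * ENNReal.ofReal
          (1 / ProbabilityTheory.beta α β * x ^ (α - 1) * (1 - x) ^ (β - 1)) := by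
        refine setLIntegral_congr_fun measurableSet_Ioo fun x hx => ?_
        have h1 : 0 < 1 - x := sub_pos.2 hx.2
        have h2 : r - r * x = r * (1 - x) := by ring
        have h3 : r ^ (α + β - 1) = r * (r ^ (α - 1) * r ^ (β - 1)) := by
          rw [show α + β - 1 = 1 + (α - 1) + (β - 1) by ring, Real.rpow_add hr, Real.rpow_add hr,
            Real.rpow_one, mul_assoc]
        rw [abs_of_pos hr, ← ENNReal.ofReal_mul hr.le, ← ENNReal.ofReal_mul (by positivity), h2,
          Real.mul_rpow hr.le hx.1.le, Real.mul_rpow hr.le h1.le, h3]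
        congr 1
        field_simp
    _ = _ := by
        rw [lintegral_const_mul' _ _ ENNReal.ofReal_ne_top, hone, mul_one]

/-- The Dirichlet integral over the simplex of size `r`. -/
def dirichletIntegral {d : ℕ} (a : Fin d → ℝ) (c r : ℝ) : ENNReal :=
  ∫⁻ x in {x : Fin d → ℝ | (∀ i, 0 ≤ x i) ∧ ∑ i, x i ≤ r},
    ENNReal.ofReal ((∏ i, x i ^ a i) * (r - ∑ i, x i) ^ c)

theorem measurableSet_simplex (d : ℕ) (r : ℝ) :
    MeasurableSet {x : Fin d → ℝ | (∀ i, 0 ≤ x i) ∧ ∑ i, x i ≤ r} := by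
  rw [Set.ofPred_and, Set.ofPred_forall]
  exact (MeasurableSet.iInter fun i => measurableSet_le measurable_const
    (measurable_pi_apply i)).inter (measurableSet_le (by fun_prop) measurable_const)

theorem dirichletIntegral_succ {d : ℕ} (a : Fin (d + 1) → ℝ) (c r : ℝ) :
    dirichletIntegral a c r = ∫⁻ t in Set.Icc 0 r,
      ENNReal.ofReal (t ^ a 0) * dirichletIntegral (fun i => a i.succ) c (r - t) := by
  have hm : Measurable ({x : Fin (d + 1) → ℝ | (∀ i, 0 ≤ x i) ∧ ∑ i, x i ≤ r}.indicator fun x =>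
      ENNReal.ofReal ((∏ i, x i ^ a i) * (r - ∑ i, x i) ^ c)) :=
    Measurable.indicator (by fun_prop) (measurableSet_simplex _ _)
  unfold dirichletIntegral
  rw [← lintegral_indicator (measurableSet_simplex _ _), ← lintegral_indicator measurableSet_Icc]
  have e := (volume_preserving_piFinSuccAbove (fun _ : Fin (d + 1) => ℝ) 0).symm
  rw [← e.lintegral_comp hm, Measure.volume_eq_prod,
    lintegral_prod _ (by exact (hm.comp e.measurable).aemeasurable)]
  refine lintegral_congr fun t => ?_
  by_cases ht : t ∈ Set.Icc 0 r
  · rw [Set.indicator_of_mem ht, ← lintegral_const_mul' _ _ ENNReal.ofReal_ne_top,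
      ← lintegral_indicator (measurableSet_simplex _ _)]
    refine lintegral_congr fun y => ?_
    have hs : ∑ i, y i ≤ r - t ↔ t + ∑ i, y i ≤ r := by
      constructor <;> intro h <;> linarith
    by_cases hy : (∀ i, 0 ≤ y i) ∧ ∑ i, y i ≤ r - t
    · rw [Set.indicator_of_mem, Set.indicator_of_mem (by exact hy)]
      · rw [← ENNReal.ofReal_mul (Real.rpow_nonneg ht.1 _)]
        simp [MeasurableEquiv.piFinSuccAbove, Fin.prod_univ_succ, Fin.sum_univ_succ, mul_assoc,
          sub_sub]
      · simpa [MeasurableEquiv.piFinSuccAbove, Fin.forall_fin_succ, Fin.sum_univ_succ, ht.1, hs]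
          using hy
    · rw [Set.indicator_of_notMem, Set.indicator_of_notMem (by exact hy)]
      simpa [MeasurableEquiv.piFinSuccAbove, Fin.forall_fin_succ, Fin.sum_univ_succ, ht.1, hs]
          using hy
  · rw [Set.indicator_of_notMem ht, lintegral_eq_zero_iff' (by
      exact (hm.comp
        (e.measurable.comp measurable_prodMk_left)).aemeasurable)]
    refine Filter.Eventually.of_forall fun y => ?_
    refine Set.indicator_of_notMem (fun hy => ht ?_) _
    simp only [MeasurableEquiv.piFinSuccAbove, Set.mem_ofPred_eq, Fin.forall_fin_succ,
      Fin.sum_univ_succ] at hy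
    simp at hy
    exact ⟨hy.1.1, by linarith [Finset.sum_nonneg fun i (_ : i ∈ Finset.univ) => hy.1.2 i]⟩

theorem dirichletIntegral_eq {d : ℕ} (a : Fin d → ℝ) (c r : ℝ) (ha : ∀ i, -1 < a i)
    (hc : -1 < c) (hr : 0 < r) :
    dirichletIntegral a c r = ENNReal.ofReal (r ^ (∑ i, a i + d + c) *
      ((∏ i, Real.Gamma (a i + 1)) * Real.Gamma (c + 1) /
        Real.Gamma (∑ i, a i + d + c + 1))) := by
  induction d generalizing r with
  | zero =>
    have : Real.Gamma (c + 1) ≠ 0 := (Real.Gamma_pos_of_pos (by linarith)).ne'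
    simp [dirichletIntegral, hr.le, this, volume_pi]
  | succ d ih =>
    set A := ∑ i : Fin d, a i.succ + d + c with hA
    have hAc : -1 < A := by
      have : ∑ i : Fin d, (-1 : ℝ) ≤ ∑ i : Fin d, a i.succ :=
        Finset.sum_le_sum fun i _ => (ha _).le
      simp at this
      linarith
    set K := (∏ i : Fin d, Real.Gamma (a i.succ + 1)) * Real.Gamma (c + 1) /
        Real.Gamma (A + 1) with hK
    have hG := Real.Gamma_pos_of_pos (show 0 < A + 1 by linarith)
    have hK0 : 0 ≤ K := div_nonneg (mul_nonneg (Finset.prod_nonneg fun i _ =>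
      (Real.Gamma_pos_of_pos (by linarith [ha i.succ])).le)
      (Real.Gamma_pos_of_pos (by linarith)).le) hG.le
    have h0 := ha 0
    rw [dirichletIntegral_succ, ← setLIntegral_congr Ioo_ae_eq_Icc]
    calc _ = ∫⁻ t in Set.Ioo 0 r, ENNReal.ofReal K *
            ENNReal.ofReal (t ^ ((a 0 + 1) - 1) * (r - t) ^ ((A + 1) - 1)) := by
          refine setLIntegral_congr_fun measurableSet_Ioo fun t ht => ?_
          rw [ih _ _ (fun i => ha i.succ) (sub_pos.2 ht.2),
            ← ENNReal.ofReal_mul (Real.rpow_nonneg ht.1.le _), ← ENNReal.ofReal_mul hK0]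
          simp only [add_sub_cancel_right]
          congr 1
          ring
      _ = _ := by
          rw [lintegral_const_mul' _ _ ENNReal.ofReal_ne_top,
            lintegral_Ioo_rpow_mul_sub_rpow (by linarith) (by linarith) hr,
            ← ENNReal.ofReal_mul hK0, ProbabilityTheory.beta, hK, Fin.prod_univ_succ,
            Fin.sum_univ_succ]
          have e1 : a 0 + ∑ i : Fin d, a i.succ + ((d + 1 : ℕ) : ℝ) + c = a 0 + 1 + (A + 1) - 1 := by
            rw [hA]; push_cast; ring
          rw [e1]
          simp only [sub_add_cancel]
          congr 1
          field_simp

theorem measurableSet_Splx (d : ℕ) : MeasurableSet (Splx d) := measurableSet_simplex d 1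

section Weight

variable {d : ℕ} {κ : Fin (d + 1) → ℝ}

theorem Wk_nonneg {x : Fin d → ℝ} (hx : x ∈ Splx d) : 0 ≤ Wk κ x :=
  mul_nonneg (Finset.prod_nonneg fun i _ => Real.rpow_nonneg (hx.1 i) _)
    (Real.rpow_nonneg (sub_nonneg.2 hx.2) _)

theorem measurable_Wk : Measurable (Wk κ) := by
  unfold Wk
  fun_prop

/-- The value of the Dirichlet integral `∫ W_κ`. -/
def dirichletValue (κ : Fin (d + 1) → ℝ) : ℝ :=
  (∏ i, Real.Gamma (κ i + 1)) / Real.Gamma (∑ i, κ i + d + 1)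

theorem sum_add_pos (hκ : ∀ i, -1 < κ i) : 0 < ∑ i, κ i + d + 1 := by
  have : ∑ _i : Fin (d + 1), (-1 : ℝ) < ∑ i, κ i :=
    Finset.sum_lt_sum_of_nonempty Finset.univ_nonempty fun i _ => hκ i
  simp at this
  linarith

theorem dirichletValue_pos (hκ : ∀ i, -1 < κ i) : 0 < dirichletValue κ :=
  div_pos (Finset.prod_pos fun i _ => Real.Gamma_pos_of_pos (by linarith [hκ i]))
    (Real.Gamma_pos_of_pos (sum_add_pos hκ))

theorem bk_pos (hκ : ∀ i, -1 < κ i) : 0 < bk κ :=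
  div_pos (Real.Gamma_pos_of_pos (sum_add_pos hκ))
    (Finset.prod_pos fun i _ => Real.Gamma_pos_of_pos (by linarith [hκ i]))

theorem lintegral_Wk (hκ : ∀ i, -1 < κ i) :
    ∫⁻ x in Splx d, ENNReal.ofReal (Wk κ x) = ENNReal.ofReal (dirichletValue κ) := by
  have h := dirichletIntegral_eq (fun i : Fin d => κ i.castSucc) (κ (Fin.last d)) 1
    (fun i => hκ _) (hκ _) one_pos
  simp only [Real.one_rpow, one_mul] at h
  simp only [dirichletValue, Fin.prod_univ_castSucc, Fin.sum_univ_castSucc]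
  rw [add_right_comm _ _ (d : ℝ), ← h]
  rfl

theorem integrableOn_Wk (hκ : ∀ i, -1 < κ i) : IntegrableOn (Wk κ) (Splx d) := by
  refine ⟨measurable_Wk.aestronglyMeasurable, ?_⟩
  rw [hasFiniteIntegral_iff_ofReal ((ae_restrict_iff' (measurableSet_Splx d)).2
    (Filter.Eventually.of_forall fun x hx => Wk_nonneg hx)), lintegral_Wk hκ]
  exact ENNReal.ofReal_lt_top

theorem integral_Wk (hκ : ∀ i, -1 < κ i) : ∫ x in Splx d, Wk κ x = dirichletValue κ := by
  rw [integral_eq_lintegral_of_nonneg_ae ((ae_restrict_iff' (measurableSet_Splx d)).2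
    (Filter.Eventually.of_forall fun x hx => Wk_nonneg hx))
    measurable_Wk.aestronglyMeasurable, lintegral_Wk hκ,
    ENNReal.toReal_ofReal (dirichletValue_pos hκ).le]

theorem dirichletValue_add_single (hκ : ∀ i, -1 < κ i) (j : Fin (d + 1)) :
    dirichletValue (κ + Pi.single j 1) =
      (κ j + 1) * ((∏ i, Real.Gamma (κ i + 1)) / Real.Gamma (∑ i, κ i + d + 2)) := by
  have h1 : ∀ i, Real.Gamma ((κ + Pi.single j 1 : Fin (d + 1) → ℝ) i + 1) =
      Real.Gamma (κ i + 1) * if i = j then κ j + 1 else 1 := by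
    intro i
    by_cases h : i = j
    · subst h
      simp only [Pi.add_apply, Pi.single_eq_same, if_true]
      rw [Real.Gamma_add_one (by linarith [hκ i]), mul_comm]
    · simp [h]
  rw [dirichletValue, Finset.prod_congr rfl fun i _ => h1 i, Finset.prod_mul_distrib]
  simp only [Finset.prod_ite_eq', Finset.mem_univ, if_true, Pi.add_apply, Finset.sum_add_distrib,
    Finset.sum_pi_single']
  rw [show ∑ i, κ i + 1 + (d : ℝ) + 1 = ∑ i, κ i + d + 2 by ring]
  ring

theorem rpow_add_natCast_of_nonneg {x y : ℝ} (hx : 0 ≤ x) (hy : -1 < y) (n : ℕ) :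
    x ^ (y + n) = x ^ y * x ^ n := by
  rcases hx.eq_or_lt with rfl | hx
  · rcases n.eq_zero_or_pos with rfl | hn
    · simp
    · have : (1 : ℝ) ≤ n := by exact_mod_cast hn
      rw [Real.zero_rpow (by linarith), zero_pow hn.ne', mul_zero]
  · exact Real.rpow_add_natCast hx.ne' y n

theorem Wk_add_natCast (hκ : ∀ i, -1 < κ i) (γ : Fin (d + 1) → ℕ) {x : Fin d → ℝ}
    (hx : x ∈ Splx d) :
    Wk (fun i => κ i + γ i) x =
      ((∏ i : Fin d, x i ^ γ i.castSucc) * (1 - ∑ i, x i) ^ γ (Fin.last d)) * Wk κ x := by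
  simp only [Wk]
  rw [rpow_add_natCast_of_nonneg (sub_nonneg.2 hx.2) (hκ _),
    Finset.prod_congr rfl fun i _ => rpow_add_natCast_of_nonneg (hx.1 i) (hκ _) _,
    Finset.prod_mul_distrib]
  ring

end Weight

open MvPolynomial

section Functional

variable {d : ℕ} {κ : Fin (d + 1) → ℝ}

/-- The exponent of a monomial in the barycentric coordinates. -/
def baryExp (β : Fin d →₀ ℕ) : Fin (d + 1) → ℕ := Fin.snoc (α := fun _ => ℕ) β 0

/-- The barycentric coordinates `x_1, …, x_d, 1 - |x|` as polynomials. -/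
def bary : Fin (d + 1) → MvPolynomial (Fin d) ℝ :=
  Fin.snoc (α := fun _ => MvPolynomial (Fin d) ℝ) X (1 - ∑ i, X i)

/-- The derivations `∂_1, …, ∂_d, 0`. -/
def baryDeriv : Fin (d + 1) → Derivation ℝ (MvPolynomial (Fin d) ℝ) (MvPolynomial (Fin d) ℝ) :=
  Fin.snoc (α := fun _ => Derivation ℝ (MvPolynomial (Fin d) ℝ) (MvPolynomial (Fin d) ℝ))
    (fun i => pderiv i) 0

@[simp] theorem baryExp_castSucc (β : Fin d →₀ ℕ) (i : Fin d) : baryExp β i.castSucc = β i := by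
  simp [baryExp]

@[simp] theorem baryExp_last (β : Fin d →₀ ℕ) : baryExp β (Fin.last d) = 0 := by
  simp [baryExp]

@[simp] theorem bary_castSucc (i : Fin d) : bary i.castSucc = X i := by
  simp [bary]

@[simp] theorem bary_last : bary (Fin.last d) = 1 - ∑ i : Fin d, X i := by
  simp [bary]

@[simp] theorem baryDeriv_castSucc (i : Fin d) : baryDeriv i.castSucc = pderiv (R := ℝ) i := by
  simp [baryDeriv]

@[simp] theorem baryDeriv_last : baryDeriv (Fin.last d) = 0 := by
  simp [baryDeriv]

theorem sum_bary : ∑ i : Fin (d + 1), bary i = 1 := by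
  simp [Fin.sum_univ_castSucc]

theorem eval_bary_nonneg {x : Fin d → ℝ} (hx : x ∈ Splx d) (i : Fin (d + 1)) :
    0 ≤ eval x (bary i) := by
  cases i using Fin.lastCases with
  | last => simpa using hx.2
  | cast i => simpa using hx.1 i

theorem eval_monomial_mul_Wk (hκ : ∀ i, -1 < κ i) (β : Fin d →₀ ℕ) {x : Fin d → ℝ}
    (hx : x ∈ Splx d) :
    eval x (monomial β 1) * Wk κ x = Wk (fun i => κ i + baryExp β i) x := by
  simp [Wk_add_natCast hκ _ hx, eval_monomial, Finsupp.prod_fintype]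

theorem eval_bary_mul_Wk (hκ : ∀ i, -1 < κ i) (j : Fin (d + 1)) {x : Fin d → ℝ}
    (hx : x ∈ Splx d) :
    eval x (bary j) * Wk κ x = Wk (κ + Pi.single j 1) x := by
  have h := Wk_add_natCast hκ (Pi.single j 1) hx
  have e : (fun i => κ i + ((Pi.single j 1 : Fin (d + 1) → ℕ) i : ℝ)) = κ + Pi.single j 1 := by
    ext i
    by_cases hi : i = j
    · subst hi; simp
    · simp [hi]
  rw [← e, h]
  cases j using Fin.lastCases with
  | last => simp
  | cast j => simp [Pi.single_apply]

theorem integrableOn_eval_mul_Wk (hκ : ∀ i, -1 < κ i) (p : MvPolynomial (Fin d) ℝ) :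
    IntegrableOn (fun x => eval x p * Wk κ x) (Splx d) := by
  induction p using MvPolynomial.monomial_add_induction_on with
  | C a =>
    simp only [eval_C]
    exact (integrableOn_Wk hκ).const_mul a
  | monomial_add β b f _ _ ih =>
    simp only [map_add, add_mul]
    refine Integrable.add ?_ ih
    have hγ : ∀ i, -1 < κ i + baryExp β i := fun i => by
      have := hκ i; have : (0 : ℝ) ≤ baryExp β i := Nat.cast_nonneg _; linarith
    refine IntegrableOn.congr_fun ((integrableOn_Wk hγ).const_mul b) (fun x hx => ?_)
      (measurableSet_Splx d)
    rw [← eval_monomial_mul_Wk hκ β hx, ← mul_assoc, eval_monomial, eval_monomial, one_mul]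

/-- Integration of a polynomial against `W_κ`, as a linear functional. -/
def polyInt (hκ : ∀ i, -1 < κ i) : MvPolynomial (Fin d) ℝ →ₗ[ℝ] ℝ where
  toFun p := ∫ x in Splx d, eval x p * Wk κ x
  map_add' p q := by
    simp only [map_add, add_mul]
    exact integral_add (integrableOn_eval_mul_Wk hκ p) (integrableOn_eval_mul_Wk hκ q)
  map_smul' c p := by
    simp only [smul_eval, mul_assoc, RingHom.id_apply, smul_eq_mul]
    exact integral_const_mul _ _

theorem polyInt_nonneg (hκ : ∀ i, -1 < κ i) {p : MvPolynomial (Fin d) ℝ}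
    (hp : ∀ x ∈ Splx d, 0 ≤ eval x p) : 0 ≤ polyInt hκ p :=
  setIntegral_nonneg (measurableSet_Splx d) fun x hx => mul_nonneg (hp x hx) (Wk_nonneg hx)

theorem polyInt_bary_mul_monomial (hκ : ∀ i, -1 < κ i) (j : Fin (d + 1)) (β : Fin d →₀ ℕ) :
    polyInt hκ (bary j * monomial β 1) =
      dirichletValue ((fun i => κ i + baryExp β i) + Pi.single j 1) := by
  have hγ : ∀ i, -1 < κ i + baryExp β i := fun i => by
    have := hκ i; have : (0 : ℝ) ≤ baryExp β i := Nat.cast_nonneg _; linarith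
  rw [← integral_Wk]
  · refine setIntegral_congr_fun (measurableSet_Splx d) fun x hx => ?_
    rw [map_mul, mul_assoc, eval_monomial_mul_Wk hκ β hx, eval_bary_mul_Wk hγ j hx]
  · intro i
    have : (0 : ℝ) ≤ (Pi.single j 1 : Fin (d + 1) → ℝ) i :=
      (Pi.single_nonneg (α := fun _ => ℝ)).2 zero_le_one i
    have := hγ i
    simp only [Pi.add_apply]
    linarith

theorem bary_mul_baryDeriv_monomial (i : Fin (d + 1)) (β : Fin d →₀ ℕ) :
    bary i * baryDeriv i (monomial β 1) = (baryExp β i : ℝ) • monomial β (1 : ℝ) := by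
  cases i using Fin.lastCases with
  | last => simp
  | cast i =>
    simp only [bary_castSucc, baryDeriv_castSucc, baryExp_castSucc]
    rw [X_mul_pderiv_monomial, Nat.cast_smul_eq_nsmul]

/-- The divergence theorem for the field `x_i x_j h W_κ` in the direction `∂_{i,j}`. -/
theorem polyInt_divergence (hκ : ∀ i, -1 < κ i) (i j : Fin (d + 1))
    (h : MvPolynomial (Fin d) ℝ) :
    polyInt hκ ((κ i + 1) • (bary j * h) - (κ j + 1) • (bary i * h) +
      bary i * bary j * (baryDeriv i h - baryDeriv j h)) = 0 := by
  induction h using MvPolynomial.induction_on' with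
  | monomial β a =>
    have hγ : ∀ i, -1 < κ i + baryExp β i := fun i => by
      have := hκ i; have : (0 : ℝ) ≤ baryExp β i := Nat.cast_nonneg _; linarith
    have e1 : bary i * bary j * (baryDeriv i (monomial β (1 : ℝ)) - baryDeriv j (monomial β 1)) =
        (baryExp β i : ℝ) • (bary j * monomial β 1) -
          (baryExp β j : ℝ) • (bary i * monomial β 1) := by
      rw [← mul_smul_comm, ← mul_smul_comm]
      linear_combination bary j * bary_mul_baryDeriv_monomial i β -
        bary i * bary_mul_baryDeriv_monomial j β
    rw [show monomial β a = a • monomial β (1 : ℝ) by simp [smul_monomial]]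
    simp only [Derivation.map_smul, ← smul_sub, mul_smul_comm, e1]
    simp only [map_add, map_sub, map_smul, polyInt_bary_mul_monomial,
      dirichletValue_add_single hγ, smul_eq_mul]
    ring
  | add p q hp hq =>
    rw [← add_zero (0 : ℝ)]
    nth_rewrite 1 [← hp]
    rw [← hq, ← map_add]
    congr 1
    simp only [map_add, mul_add, smul_add]
    ring

end Functional

section Operator

variable {d : ℕ} {κ : Fin (d + 1) → ℝ}

/-- The Dirichlet form `∑_{i,j} ⟨x_i x_j ∂_{i,j} f, ∂_{i,j} g⟩` in barycentric coordinates. -/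
def dirichletForm (hκ : ∀ i, -1 < κ i) (f g : MvPolynomial (Fin d) ℝ) : ℝ :=
  ∑ i, ∑ j, polyInt hκ (bary i * bary j * (baryDeriv i f - baryDeriv j f) *
    (baryDeriv i g - baryDeriv j g))

theorem dirichletForm_comm (hκ : ∀ i, -1 < κ i) (f g : MvPolynomial (Fin d) ℝ) :
    dirichletForm hκ f g = dirichletForm hκ g f := by
  unfold dirichletForm
  simp only [mul_right_comm]

/-- The Euler operator `∑ x_i ∂_i`. -/
def eulerOp (d : ℕ) : MvPolynomial (Fin d) ℝ →ₗ[ℝ] MvPolynomial (Fin d) ℝ :=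
  ∑ i, LinearMap.mulLeft ℝ (X i) ∘ₗ (pderiv i).toLinearMap

theorem eulerOp_apply (f : MvPolynomial (Fin d) ℝ) : eulerOp d f = ∑ i, X i * pderiv i f := by
  simp [eulerOp, LinearMap.sum_apply]

/-- The degree-lowering part of the Jacobi operator. -/
def jacobiLower (κ : Fin (d + 1) → ℝ) : MvPolynomial (Fin d) ℝ →ₗ[ℝ] MvPolynomial (Fin d) ℝ :=
  ∑ i : Fin d, (LinearMap.mulLeft ℝ (X i) ∘ₗ (pderiv i).toLinearMap ∘ₗ (pderiv i).toLinearMap +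
    (κ i.castSucc + 1) • (pderiv i).toLinearMap)

theorem jacobiLower_apply (κ : Fin (d + 1) → ℝ) (f : MvPolynomial (Fin d) ℝ) :
    jacobiLower κ f =
      ∑ i : Fin d, (X i * pderiv i (pderiv i f) + (κ i.castSucc + 1) • pderiv i f) := by
  simp [jacobiLower, LinearMap.sum_apply]

/-- The differential operator whose eigenspaces are the spaces `V_n^d(W_κ)`. -/
def jacobiOp (κ : Fin (d + 1) → ℝ) : MvPolynomial (Fin d) ℝ →ₗ[ℝ] MvPolynomial (Fin d) ℝ :=
  jacobiLower κ - eulerOp d ∘ₗ eulerOp d - (∑ i, κ i + d) • eulerOp d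

theorem jacobiOp_apply (κ : Fin (d + 1) → ℝ) (f : MvPolynomial (Fin d) ℝ) :
    jacobiOp κ f = jacobiLower κ f - eulerOp d (eulerOp d f) - (∑ i, κ i + d) • eulerOp d f := by
  simp [jacobiOp]

theorem sum_sum_smul_sub_add {ι R : Type*} [Fintype ι] [CommRing R] (k w a : ι → R)
    (b : ι → ι → R) (hw : ∑ i, w i = 1) (hb : ∀ i j, b i j = b j i) :
    ∑ i, ∑ j, (k i * (w j * (a i - a j)) - k j * (w i * (a i - a j)) +
      w i * w j * ((b i i - b i j) - (b j i - b j j))) =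
    2 * (∑ i, (w i * b i i + k i * a i) - ∑ i, ∑ j, w i * w j * b i j -
      (∑ i, k i) * ∑ i, w i * a i) := by
  have h1 : ∑ i, ∑ j, k i * (w j * (a i - a j)) =
      ∑ i, k i * a i - (∑ i, k i) * ∑ i, w i * a i := by
    simp only [mul_sub, Finset.sum_sub_distrib, ← Finset.mul_sum, ← Finset.sum_mul, hw, one_mul]
  have h2 : ∑ i, ∑ j, k j * (w i * (a i - a j)) = -∑ i, ∑ j, k i * (w j * (a i - a j)) := by
    rw [Finset.sum_comm, ← Finset.sum_neg_distrib]
    refine Finset.sum_congr rfl fun i _ => ?_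
    rw [← Finset.sum_neg_distrib]
    exact Finset.sum_congr rfl fun j _ => by ring
  have h3 : ∑ i, ∑ j, w i * w j * b i i = ∑ i, w i * b i i := by
    refine Finset.sum_congr rfl fun i _ => ?_
    rw [← Finset.sum_mul, ← Finset.mul_sum, hw, mul_one]
  have h4 : ∑ i, ∑ j, w i * w j * b j j = ∑ i, w i * b i i := by
    rw [Finset.sum_comm, ← h3]
    exact Finset.sum_congr rfl fun i _ => Finset.sum_congr rfl fun j _ => by ring
  have h5 : ∀ i j, w i * w j * ((b i i - b i j) - (b j i - b j j)) =
      w i * w j * b i i + w i * w j * b j j - 2 * (w i * w j * b i j) := fun i j => by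
    rw [hb j i]; ring
  have h6 : ∑ i, ∑ j, 2 * (w i * w j * b i j) = 2 * ∑ i, ∑ j, w i * w j * b i j := by
    simp only [Finset.mul_sum]
  simp only [h5, Finset.sum_add_distrib, Finset.sum_sub_distrib, h6, h2, h3, h4, h1]
  ring

theorem pderiv_comm (i j : Fin d) (f : MvPolynomial (Fin d) ℝ) :
    pderiv i (pderiv j f) = pderiv j (pderiv i f) := by
  have h : ⁅pderiv (R := ℝ) i, pderiv (R := ℝ) j⁆ = 0 :=
    derivation_ext fun k => by
      classical
      simp [Derivation.commutator_apply, pderiv_X, Pi.single_apply, apply_ite]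
  have := DFunLike.congr_fun h f
  rwa [Derivation.commutator_apply, Derivation.zero_apply, sub_eq_zero] at this

theorem baryDeriv_comm (i j : Fin (d + 1)) (f : MvPolynomial (Fin d) ℝ) :
    baryDeriv i (baryDeriv j f) = baryDeriv j (baryDeriv i f) := by
  cases i using Fin.lastCases <;> cases j using Fin.lastCases <;> simp [pderiv_comm]

theorem sum_baryDeriv_eq_jacobiOp (κ : Fin (d + 1) → ℝ) (f : MvPolynomial (Fin d) ℝ) :
    ∑ i, ∑ j, ((κ i + 1) • (bary j * (baryDeriv i f - baryDeriv j f)) -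
      (κ j + 1) • (bary i * (baryDeriv i f - baryDeriv j f)) +
      bary i * bary j * (baryDeriv i (baryDeriv i f - baryDeriv j f) -
        baryDeriv j (baryDeriv i f - baryDeriv j f))) = 2 * jacobiOp κ f := by
  have h := sum_sum_smul_sub_add (fun i => C (κ i + 1)) bary (fun i => baryDeriv i f)
    (fun i j => baryDeriv i (baryDeriv j f)) sum_bary (fun i j => baryDeriv_comm i j f)
  simp only [← smul_eq_C_mul, ← map_sub] at h
  rw [h]
  congr 1
  have hE : eulerOp d (eulerOp d f) =
      ∑ i : Fin d, ∑ j : Fin d, X i * X j * pderiv i (pderiv j f) + eulerOp d f := by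
    rw [eulerOp_apply, eulerOp_apply, ← Finset.sum_add_distrib]
    refine Finset.sum_congr rfl fun i _ => ?_
    rw [map_sum, Finset.mul_sum]
    simp only [pderiv_mul, pderiv_X, Pi.single_apply, ite_mul, one_mul, zero_mul, mul_add,
      Finset.sum_add_distrib, mul_ite, mul_zero, Finset.sum_ite_eq', Finset.mem_univ,
      if_true]
    rw [add_comm]
    simp only [mul_assoc]
  have hk : ∑ i, C (σ := Fin d) (κ i + 1) = C (∑ i, κ i + d + 1) := by
    rw [← map_sum]
    congr 1
    simp [Finset.sum_add_distrib]
    ring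
  rw [jacobiOp_apply, jacobiLower_apply, hE, hk]
  simp only [Fin.sum_univ_castSucc, bary_castSucc, baryDeriv_castSucc, baryDeriv_last,
    Derivation.zero_apply, map_zero, mul_zero, add_zero, Finset.sum_const_zero,
    ← eulerOp_apply, smul_eq_C_mul, map_add, map_one]
  ring

theorem dirichletForm_eq (hκ : ∀ i, -1 < κ i) (f g : MvPolynomial (Fin d) ℝ) :
    dirichletForm hκ f g = -(2 * polyInt hκ (g * jacobiOp κ f)) := by
  have h : ∀ i j, polyInt hκ (bary i * bary j * (baryDeriv i f - baryDeriv j f) *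
      (baryDeriv i g - baryDeriv j g)) = -polyInt hκ (g *
      ((κ i + 1) • (bary j * (baryDeriv i f - baryDeriv j f)) -
      (κ j + 1) • (bary i * (baryDeriv i f - baryDeriv j f)) +
      bary i * bary j * (baryDeriv i (baryDeriv i f - baryDeriv j f) -
        baryDeriv j (baryDeriv i f - baryDeriv j f)))) := by
    intro i j
    rw [eq_neg_iff_add_eq_zero, ← map_add,
      ← polyInt_divergence hκ i j (g * (baryDeriv i f - baryDeriv j f))]
    congr 1
    simp only [Derivation.leibniz, smul_eq_mul, smul_eq_C_mul]
    ring
  simp only [dirichletForm, h, Finset.sum_neg_distrib, ← map_sum, ← Finset.mul_sum]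
  rw [sum_baryDeriv_eq_jacobiOp, mul_left_comm, two_mul, map_add, ← two_mul]

theorem polyInt_mul_jacobiOp_comm (hκ : ∀ i, -1 < κ i) (f g : MvPolynomial (Fin d) ℝ) :
    polyInt hκ (g * jacobiOp κ f) = polyInt hκ (f * jacobiOp κ g) := by
  have := dirichletForm_comm hκ f g
  rw [dirichletForm_eq, dirichletForm_eq] at this
  linarith

/-- The polynomials of degree less than `m` (with the zero polynomial of degree `-∞`). -/
def degLT (d m : ℕ) : Submodule ℝ (MvPolynomial (Fin d) ℝ) :=
  restrictSupport ℝ {α | α.degree < m}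

theorem monomial_mem_degLT {m : ℕ} {β : Fin d →₀ ℕ} (h : β.degree < m) (a : ℝ) :
    monomial β a ∈ degLT d m :=
  (monomial_mem_restrictSupport ℝ).2 (Or.inl h)

theorem degLT_mono {m n : ℕ} (h : m ≤ n) : degLT d m ≤ degLT d n :=
  restrictSupport_mono _ fun _ hα => lt_of_lt_of_le hα h

theorem mem_degLT_zero {f : MvPolynomial (Fin d) ℝ} : f ∈ degLT d 0 ↔ f = 0 := by
  simp [degLT, mem_restrictSupport_iff]

theorem mem_degLT_succ {m : ℕ} {f : MvPolynomial (Fin d) ℝ} :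
    f ∈ degLT d (m + 1) ↔ f.totalDegree ≤ m := by
  rw [degLT, mem_restrictSupport_iff, totalDegree, Finset.sup_le_iff]
  exact forall₂_congr fun β _ => Nat.lt_succ_iff

theorem mem_degLT_of_totalDegree_lt {m : ℕ} {f : MvPolynomial (Fin d) ℝ}
    (h : f.totalDegree < m) : f ∈ degLT d m := by
  obtain ⟨m, rfl⟩ := Nat.exists_eq_add_of_lt h
  exact degLT_mono (by omega) (mem_degLT_succ.2 le_rfl)

theorem map_mem_of_monomial {m : ℕ} {T : MvPolynomial (Fin d) ℝ →ₗ[ℝ] MvPolynomial (Fin d) ℝ}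
    {S : Submodule ℝ (MvPolynomial (Fin d) ℝ)}
    (h : ∀ β : Fin d →₀ ℕ, β.degree < m → T (monomial β 1) ∈ S)
    {f : MvPolynomial (Fin d) ℝ} (hf : f ∈ degLT d m) : T f ∈ S := by
  have : degLT d m ≤ S.comap T := by
    rw [degLT, restrictSupport_eq_span, Submodule.span_le]
    rintro _ ⟨β, hβ, rfl⟩
    exact h β hβ
  exact this hf

theorem eulerOp_monomial (β : Fin d →₀ ℕ) :
    eulerOp d (monomial β 1) = (β.degree : ℝ) • monomial β 1 := by
  rw [eulerOp_apply]
  simp only [X_mul_pderiv_monomial, ← Finset.sum_smul, Finsupp.degree_eq_sum, Nat.cast_smul_eq_nsmul]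

theorem jacobiLower_monomial_mem (κ : Fin (d + 1) → ℝ) (β : Fin d →₀ ℕ) :
    jacobiLower κ (monomial β 1) ∈ degLT d β.degree := by
  rw [jacobiLower_apply]
  refine Submodule.sum_mem _ fun i _ => ?_
  have h : pderiv i (monomial β (1 : ℝ)) ∈ degLT d β.degree := by
    rw [pderiv_monomial]
    by_cases hi : β i = 0
    · simp [hi]
    · refine monomial_mem_degLT ?_ _
      have hle : Finsupp.single i 1 ≤ β :=
        Finsupp.single_le_iff.2 (Nat.one_le_iff_ne_zero.2 hi)
      conv_rhs => rw [← tsub_add_cancel_of_le hle, map_add, Finsupp.degree_single]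
      exact Nat.lt_succ_self _
  refine Submodule.add_mem _ ?_ (Submodule.smul_mem _ _ h)
  rw [pderiv_monomial] at h ⊢
  rw [X_mul_pderiv_monomial]
  exact Submodule.smul_of_tower_mem _ _ h

/-- The eigenvalue `m (m + |κ| + d)`. -/
def jacobiEigen (κ : Fin (d + 1) → ℝ) (m : ℕ) : ℝ := m * (m + ∑ i, κ i + d)

theorem jacobiEigen_strictMono (hκ : ∀ i, -1 < κ i) : StrictMono (jacobiEigen κ) := by
  refine strictMono_nat_of_lt_succ fun m => ?_
  have := sum_add_pos hκ
  have : (0 : ℝ) ≤ m := Nat.cast_nonneg m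
  unfold jacobiEigen
  push_cast
  nlinarith

theorem jacobiOp_monomial (κ : Fin (d + 1) → ℝ) (β : Fin d →₀ ℕ) :
    jacobiOp κ (monomial β 1) =
      jacobiLower κ (monomial β 1) - jacobiEigen κ β.degree • monomial β 1 := by
  rw [jacobiOp_apply]
  simp only [eulerOp_monomial, map_smul, smul_smul, jacobiEigen, sub_sub, ← add_smul]
  congr 2
  ring

theorem jacobiOp_mem {m : ℕ} {f : MvPolynomial (Fin d) ℝ} (hf : f ∈ degLT d m) :
    jacobiOp κ f ∈ degLT d m := by
  refine map_mem_of_monomial (fun β hβ => ?_) hf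
  rw [jacobiOp_monomial]
  exact Submodule.sub_mem _ (degLT_mono hβ.le (jacobiLower_monomial_mem κ β))
    (Submodule.smul_mem _ _ (monomial_mem_degLT hβ 1))

theorem jacobiOp_add_smul_mem {m : ℕ} {f : MvPolynomial (Fin d) ℝ} (hf : f ∈ degLT d (m + 1)) :
    jacobiOp κ f + jacobiEigen κ m • f ∈ degLT d m := by
  refine map_mem_of_monomial (T := jacobiOp κ + jacobiEigen κ m • LinearMap.id)
    (fun β hβ => ?_) hf
  simp only [LinearMap.add_apply, LinearMap.smul_apply, LinearMap.id_apply]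
  rcases Nat.lt_succ_iff_lt_or_eq.1 hβ with h | rfl
  · have := monomial_mem_degLT h (1 : ℝ)
    exact Submodule.add_mem _ (jacobiOp_mem this) (Submodule.smul_mem _ _ this)
  · rw [jacobiOp_monomial, sub_add_cancel]
    exact jacobiLower_monomial_mem κ β

theorem exists_jacobiOp_add_smul_eq (hκ : ∀ i, -1 < κ i) {m n : ℕ} (hmn : m ≤ n)
    {g : MvPolynomial (Fin d) ℝ} (hg : g ∈ degLT d m) :
    ∃ h ∈ degLT d m, jacobiOp κ h + jacobiEigen κ n • h = g := by
  induction m generalizing g with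
  | zero => exact ⟨0, Submodule.zero_mem _, by simp [mem_degLT_zero.1 hg]⟩
  | succ m ih =>
    have hc : jacobiEigen κ n - jacobiEigen κ m ≠ 0 :=
      (sub_pos.2 (jacobiEigen_strictMono hκ hmn)).ne'
    set c := jacobiEigen κ n - jacobiEigen κ m with hcdef
    obtain ⟨h, hh, he⟩ := ih (by omega)
      (Submodule.smul_mem _ (-c⁻¹) (jacobiOp_add_smul_mem (κ := κ) hg))
    refine ⟨c⁻¹ • g + h, Submodule.add_mem _ (Submodule.smul_mem _ _ hg)
      (degLT_mono (Nat.le_succ m) hh), ?_⟩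
    have hn : jacobiEigen κ n = c + jacobiEigen κ m := by rw [hcdef]; ring
    have : jacobiOp κ (c⁻¹ • g + h) + jacobiEigen κ n • (c⁻¹ • g + h) =
        c⁻¹ • jacobiOp κ g + jacobiEigen κ n • c⁻¹ • g +
          (jacobiOp κ h + jacobiEigen κ n • h) := by
      rw [map_add, map_smul, smul_add]; abel
    rw [this, he, hn, add_smul, smul_smul c, mul_inv_cancel₀ hc, one_smul]
    module

end Operator

section Spectral

variable {d : ℕ} {κ : Fin (d + 1) → ℝ}

theorem polyInt_mul_self_nonneg (hκ : ∀ i, -1 < κ i) (p : MvPolynomial (Fin d) ℝ) :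
    0 ≤ polyInt hκ (p * p) :=
  polyInt_nonneg hκ fun x _ => by
    rw [map_mul]
    exact mul_self_nonneg _

theorem polyInt_mul_eq_zero (hκ : ∀ i, -1 < κ i) {q : MvPolynomial (Fin d) ℝ}
    (hq : polyInt hκ (q * q) = 0) (g : MvPolynomial (Fin d) ℝ) : polyInt hκ (q * g) = 0 := by
  have key : ∀ t : ℝ, 0 ≤ 2 * t * polyInt hκ (q * g) + polyInt hκ (g * g) := fun t => by
    have h := polyInt_mul_self_nonneg hκ (t • q + g)
    have e : (t • q + g) * (t • q + g) = (t * t) • (q * q) + (2 * t) • (q * g) + g * g := by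
      simp only [smul_eq_C_mul, map_mul, map_ofNat]
      ring
    simpa [e, hq] using h
  by_contra hne
  have h := key (-(polyInt hκ (g * g) + 1) / (2 * polyInt hκ (q * g)))
  have e : 2 * (-(polyInt hκ (g * g) + 1) / (2 * polyInt hκ (q * g))) * polyInt hκ (q * g) =
      -(polyInt hκ (g * g) + 1) := by
    field_simp
  rw [e] at h
  linarith

theorem exists_eigen_decomposition (hκ : ∀ i, -1 < κ i) {n : ℕ} {f : MvPolynomial (Fin d) ℝ}
    (hf : f ∈ degLT d (n + 1)) :
    ∃ p, ∃ q ∈ degLT d n, f = p + q ∧ (∀ g ∈ degLT d n, polyInt hκ (p * g) = 0) ∧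
      polyInt hκ (f * f) = polyInt hκ (p * p) + polyInt hκ (q * q) ∧
      -polyInt hκ (f * jacobiOp κ f) =
        jacobiEigen κ n * polyInt hκ (p * p) - polyInt hκ (q * jacobiOp κ q) := by
  obtain ⟨q, hq, hqe⟩ :=
    exists_jacobiOp_add_smul_eq hκ le_rfl (jacobiOp_add_smul_mem (κ := κ) hf)
  have hp : jacobiOp κ (f - q) = -(jacobiEigen κ n • (f - q)) := by
    rw [map_sub, smul_sub]
    linear_combination -hqe
  obtain ⟨p, rfl⟩ : ∃ p, f = p + q := ⟨f - q, by ring⟩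
  rw [add_sub_cancel_right] at hp
  have horth : ∀ g ∈ degLT d n, polyInt hκ (p * g) = 0 := fun g hg => by
    obtain ⟨h, -, rfl⟩ := exists_jacobiOp_add_smul_eq hκ le_rfl hg
    rw [mul_add, map_add, polyInt_mul_jacobiOp_comm, hp]
    simp [mul_comm h p]
  refine ⟨p, q, hq, rfl, horth, ?_, ?_⟩
  · have e : (p + q) * (p + q) = p * p + (p * q + p * q) + q * q := by ring
    simp [e, horth q hq]
  · have hqp : polyInt hκ (q * jacobiOp κ p) = 0 := by
      rw [polyInt_mul_jacobiOp_comm, horth _ (jacobiOp_mem hq)]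
    simp only [map_add, mul_add, add_mul, hqp, horth _ (jacobiOp_mem hq)]
    simp [hp]
    ring

theorem neg_polyInt_mul_jacobiOp_le (hκ : ∀ i, -1 < κ i) {n : ℕ} {f : MvPolynomial (Fin d) ℝ}
    (hf : f ∈ degLT d (n + 1)) :
    -polyInt hκ (f * jacobiOp κ f) ≤ jacobiEigen κ n * polyInt hκ (f * f) := by
  induction n generalizing f with
  | zero =>
    obtain ⟨p, q, hq, -, -, h1, h2⟩ := exists_eigen_decomposition hκ hf
    rw [mem_degLT_zero] at hq
    simp [h1, h2, hq]
  | succ n ih =>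
    obtain ⟨p, q, hq, -, -, h1, h2⟩ := exists_eigen_decomposition hκ hf
    rw [h1, h2]
    have := ih hq
    have := jacobiEigen_strictMono hκ (Nat.lt_succ_self n)
    have := polyInt_mul_self_nonneg hκ q
    nlinarith

theorem neg_polyInt_mul_jacobiOp_eq_iff (hκ : ∀ i, -1 < κ i) {n : ℕ}
    {f : MvPolynomial (Fin d) ℝ} (hf : f ∈ degLT d (n + 1)) :
    -polyInt hκ (f * jacobiOp κ f) = jacobiEigen κ n * polyInt hκ (f * f) ↔
      ∀ g ∈ degLT d n, polyInt hκ (f * g) = 0 := by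
  obtain ⟨p, q, hq, hfpq, horth, h1, h2⟩ := exists_eigen_decomposition hκ hf
  rw [h1, h2]
  constructor
  · intro h
    have hq0 : polyInt hκ (q * q) = 0 := by
      cases n with
      | zero => simp [mem_degLT_zero.1 hq]
      | succ n =>
        have := neg_polyInt_mul_jacobiOp_le hκ hq
        have := jacobiEigen_strictMono hκ (Nat.lt_succ_self n)
        have := polyInt_mul_self_nonneg hκ q
        nlinarith
    intro g hg
    rw [hfpq, add_mul, map_add, horth g hg, polyInt_mul_eq_zero hκ hq0, add_zero]
  · intro h
    have hq0 : polyInt hκ (q * q) = 0 := by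
      have := h q hq
      rwa [hfpq, add_mul, map_add, horth q hq, zero_add] at this
    rw [polyInt_mul_eq_zero hκ hq0, hq0]
    ring

end Spectral

section Translation

variable {d : ℕ} {κ : Fin (d + 1) → ℝ}

theorem hasFDerivAt_eval (f : MvPolynomial (Fin d) ℝ) (x : Fin d → ℝ) :
    HasFDerivAt (fun y => eval y f)
      (∑ i, eval x (pderiv i f) • ContinuousLinearMap.proj (R := ℝ) (φ := fun _ : Fin d => ℝ) i)
      x := by
  induction f using MvPolynomial.induction_on with
  | C a => simpa using hasFDerivAt_const a x
  | add p q hp hq =>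
    have h := hp.add hq
    simp only [map_add, add_smul, Finset.sum_add_distrib]
    exact h
  | mul_X p j hp =>
    have h := hp.mul (hasFDerivAt_apply (𝕜 := ℝ) (F' := fun _ : Fin d => ℝ) j x)
    simp only [map_mul, eval_X]
    refine h.congr_fderiv ?_
    ext v
    simp [pderiv_X, Pi.single_apply, apply_ite, Finset.sum_add_distrib, add_mul,
      Finset.mul_sum, mul_assoc]

theorem pd_eval (i : Fin d) (f : MvPolynomial (Fin d) ℝ) (x : Fin d → ℝ) :
    pd i (fun y => eval y f) x = eval x (pderiv i f) := by
  rw [pd, (hasFDerivAt_eval f x).fderiv]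
  simp [Pi.single_apply]

theorem ipk_eval (hκ : ∀ i, -1 < κ i) (f g : MvPolynomial (Fin d) ℝ) :
    ipk κ (fun x => eval x f) (fun x => eval x g) = bk κ * polyInt hκ (f * g) := by
  simp [ipk, polyInt]

theorem nrm2_sqrt_mul_sq (hκ : ∀ i, -1 < κ i) {u q : MvPolynomial (Fin d) ℝ}
    (hu : ∀ x ∈ Splx d, 0 ≤ eval x u) {F : (Fin d → ℝ) → ℝ}
    (hF : ∀ x, F x = Real.sqrt (eval x u) * eval x q) :
    nrm2 κ F ^ 2 = bk κ * polyInt hκ (u * q * q) := by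
  have h : ipk κ F F = bk κ * polyInt hκ (u * q * q) := by
    unfold ipk
    congr 1
    refine setIntegral_congr_fun (measurableSet_Splx d) fun x hx => ?_
    simp only [hF, map_mul]
    linear_combination (eval x q * eval x q * Wk κ x) * Real.mul_self_sqrt (hu x hx)
  rw [nrm2, Real.sq_sqrt, h]
  rw [h]
  refine mul_nonneg (bk_pos hκ).le (polyInt_nonneg hκ fun x hx => ?_)
  rw [map_mul, map_mul, mul_assoc]
  exact mul_nonneg (hu x hx) (mul_self_nonneg _)

theorem sum_sum_eq_two_mul_sum_lt {ι : Type*} [Fintype ι] [LinearOrder ι] (T : ι → ι → ℝ)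
    (hT : ∀ i j, T i j = T j i) (h0 : ∀ i, T i i = 0) :
    ∑ i, ∑ j, T i j = 2 * ∑ i, ∑ j ∈ Finset.univ.filter (fun j => i < j), T i j := by
  have h : ∀ i j, T i j = (if i < j then T i j else 0) + if j < i then T j i else 0 := by
    intro i j
    rcases lt_trichotomy i j with hij | rfl | hij
    · simp [hij, hij.not_gt]
    · simp [h0]
    · simp [hij, hij.not_gt, hT i j]
  have e : ∑ i, ∑ j, T i j = ∑ i, ∑ j, (if i < j then T i j else 0) +
      ∑ i, ∑ j, if j < i then T j i else 0 := by
    simp only [← Finset.sum_add_distrib, ← h]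
  rw [e, Finset.sum_comm (f := fun i j => if j < i then T j i else 0), ← two_mul]
  simp only [Finset.sum_filter]

theorem bform_eval (hκ : ∀ i, -1 < κ i) (f : MvPolynomial (Fin d) ℝ) :
    bform κ (fun x => eval x f) = -(bk κ * polyInt hκ (f * jacobiOp κ f)) := by
  set T : Fin (d + 1) → Fin (d + 1) → ℝ := fun i j =>
    polyInt hκ (bary i * bary j * (baryDeriv i f - baryDeriv j f) *
      (baryDeriv i f - baryDeriv j f)) with hTdef
  have hT : ∀ i j, T i j = T j i := fun i j => by
    simp only [hTdef]
    congr 1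
    ring
  have h0 : ∀ i, T i i = 0 := fun i => by simp [hTdef]
  have h1 : ∀ i : Fin d, nrm2 κ (fun x => Real.sqrt (x i * (1 - ∑ k, x k)) *
      pd i (fun x => eval x f) x) ^ 2 = bk κ * T i.castSucc (Fin.last d) := fun i =>
    nrm2_sqrt_mul_sq hκ (fun x hx => by
      rw [map_mul]; exact mul_nonneg (eval_bary_nonneg hx _) (eval_bary_nonneg hx _))
      fun x => by simp [pd_eval]
  have h2 : ∀ i j : Fin d, nrm2 κ (fun x => Real.sqrt (x i * x j) *
      pdd i j (fun x => eval x f) x) ^ 2 = bk κ * T i.castSucc j.castSucc := fun i j =>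
    nrm2_sqrt_mul_sq hκ (fun x hx => by
      rw [map_mul]; exact mul_nonneg (eval_bary_nonneg hx _) (eval_bary_nonneg hx _))
      fun x => by simp [pd_eval, pdd]
  have hsum : ∑ i, ∑ j, T i j = -(2 * polyInt hκ (f * jacobiOp κ f)) := dirichletForm_eq hκ f f
  simp only [bform, h1, h2, ← Finset.mul_sum]
  rw [Fin.sum_univ_castSucc] at hsum
  simp only [Fin.sum_univ_castSucc, h0, Finset.sum_add_distrib, add_zero,
    fun j : Fin d => hT (Fin.last d) j.castSucc] at hsum
  rw [sum_sum_eq_two_mul_sum_lt (fun i j : Fin d => T i.castSucc j.castSucc)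
    (fun i j => hT _ _) (fun i => h0 _)] at hsum
  linear_combination (bk κ / 2) * hsum

theorem inVn_iff (hκ : ∀ i, -1 < κ i) {n : ℕ} {f : MvPolynomial (Fin d) ℝ}
    (hf : f.totalDegree ≤ n) :
    InVn d n κ f ↔ ∀ g ∈ degLT d n, polyInt hκ (f * g) = 0 := by
  simp only [InVn, hf, true_and, ipk_eval hκ, mul_eq_zero, (bk_pos hκ).ne', false_or]
  refine ⟨fun h g hg => ?_, fun h g hg => h g (mem_degLT_of_totalDegree_lt hg)⟩
  cases n with
  | zero => simp [mem_degLT_zero.1 hg]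
  | succ n => exact h g (Nat.lt_succ_of_le (mem_degLT_succ.1 hg))

end Translation

/-- equality in \eqref{eq:B-ineq0} holds iff `f ∈ V_n^d(W_κ)`. -/
theorem stmt4 (d : ℕ) (hd : 2 ≤ d) (κ : Fin (d+1) → ℝ) (hκ : ∀ i, -1 < κ i)
    (n : ℕ) (f : MvPolynomial (Fin d) ℝ) (hf : f.totalDegree ≤ n) :
    bform κ (fun x => MvPolynomial.eval x f) =
      (n : ℝ) * ((n : ℝ) + (∑ k, κ k) + (d : ℝ)) *
        nrm2 κ (fun x => MvPolynomial.eval x f) ^ 2 ↔ InVn d n κ f := by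
  rw [bform_eval hκ, inVn_iff hκ hf, ← neg_polyInt_mul_jacobiOp_eq_iff hκ (mem_degLT_succ.2 hf),
    nrm2_sqrt_mul_sq hκ (u := 1) (q := f) (by simp) (by simp), one_mul, jacobiEigen,
    mul_left_comm _ (bk κ), ← mul_neg, mul_right_inj' (bk_pos hκ).ne']
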